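/- Let u ∈ k^* and let α ∈ Aff_3(k) \ B have type (γ1,γ2,γ3). If (γ1,γ3) ∈ {(3,2), (2,3)} and γ2 ≤ 2, then the lift α̂ of α satisfies condition (C). -/

import Mathlib

open MvPolynomial

noncomputable section

namespace YasudaPaper

variable {k : Type*} [Field k]

/-- `f := x1*x3 - x2^2` (variables: `X 0 = x1, X 1 = x2, X 2 = x3`). -/
def fP : MvPolynomial (Fin 3) k := X 0 * X 2 - X 1 ^ 2

/-- `r := x2*f + x1^2`. -/
def rP : MvPolynomial (Fin 3) k := X 1 * fP + X 0 ^ 2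

/-- `g := x3*f^2 + 2*x1*x2*f + x1^3`. -/
def gP : MvPolynomial (Fin 3) k := X 2 * fP ^ 2 + 2 * X 0 * X 1 * fP + X 0 ^ 3

/-- The Jacobian derivation `Δ = Δ_{(f,g)}`, `h ↦ det ∂(f,g,h)/∂(x1,x2,x3)`. -/
def Del (h : MvPolynomial (Fin 3) k) : MvPolynomial (Fin 3) k :=
  Matrix.det !![pderiv 0 fP, pderiv 1 fP, pderiv 2 fP;
                pderiv 0 gP, pderiv 1 gP, pderiv 2 gP;
                pderiv 0 h,  pderiv 1 h,  pderiv 2 h]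

/-- `φ = exp D`: for every `h` and every `N` with `D^[N] h = 0`,
    `φ h = ∑_{i<N} D^i(h)/i!`.  (For a locally nilpotent `D` this characterizes
    the exponential automorphism.) -/
def IsExpOf {σ : Type*} (D : MvPolynomial σ k → MvPolynomial σ k)
    (φ : MvPolynomial σ k ≃ₐ[k] MvPolynomial σ k) : Prop :=
  ∀ (h : MvPolynomial σ k) (N : ℕ), D^[N] h = 0 →
    φ h = ∑ i ∈ Finset.range N, (Nat.factorial i : k)⁻¹ • D^[i] h

/-- `α` is an affine automorphism: `α(x_i) = ∑_j a_{j,i} x_j + b_i` with `A ∈ GL₃(k)`. -/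
def IsAffine (α : MvPolynomial (Fin 3) k ≃ₐ[k] MvPolynomial (Fin 3) k) : Prop :=
  ∃ (A : Matrix (Fin 3) (Fin 3) k) (b : Fin 3 → k), IsUnit A.det ∧
    ∀ i : Fin 3, α (X i) = (∑ j : Fin 3, C (A j i) * X j) + C (b i)

/-- `Aff_3(k)` as a set of automorphisms. -/
def AffSet : Set (MvPolynomial (Fin 3) k ≃ₐ[k] MvPolynomial (Fin 3) k) := {α | IsAffine α}

/-- `α` is a triangular automorphism: `α(x_i) = a_i x_i + f_i(x_1,…,x_{i-1})`, `a_i ≠ 0`. -/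
def IsTriangular (α : MvPolynomial (Fin 3) k ≃ₐ[k] MvPolynomial (Fin 3) k) : Prop :=
  ∃ (a : Fin 3 → k) (p : Fin 3 → MvPolynomial (Fin 3) k),
    (∀ i, a i ≠ 0) ∧ (∀ i, p i ∈ MvPolynomial.supported k {j | j < i}) ∧
    (∀ i, α (X i) = C (a i) * X i + p i)

/-- `BA_3(k)` as a set of automorphisms. -/
def TriSet : Set (MvPolynomial (Fin 3) k ≃ₐ[k] MvPolynomial (Fin 3) k) := {α | IsTriangular α}

/-- The tame subgroup `TA_3(k) = ⟨Aff_3(k), BA_3(k)⟩`. -/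
def TA : Subgroup (MvPolynomial (Fin 3) k ≃ₐ[k] MvPolynomial (Fin 3) k) :=
  Subgroup.closure (AffSet ∪ TriSet)

/-- `β = β_u = (u^3 x1, u^2 x2, u x3)`. -/
def IsBeta (u : k) (β : MvPolynomial (Fin 3) k ≃ₐ[k] MvPolynomial (Fin 3) k) : Prop :=
  β (X 0) = C (u ^ 3) * X 0 ∧ β (X 1) = C (u ^ 2) * X 1 ∧ β (X 2) = C u * X 2

/-- `B = {β_u | u ∈ k^*}`. -/
def BSet : Set (MvPolynomial (Fin 3) k ≃ₐ[k] MvPolynomial (Fin 3) k) :=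
  {β | ∃ u : k, u ≠ 0 ∧ IsBeta u β}

/-! Six-variable ring `k[x1,x2,x3,t_r,t_f,t_g]`:
variables `X 0 = x1, X 1 = x2, X 2 = x3, X 3 = t_r, X 4 = t_f, X 5 = t_g`. -/

/-- The inclusion of variable index sets. -/
def ι36 : Fin 3 → Fin 6 := Fin.castLE (by norm_num)

/-- The embedding `k[x1,x2,x3] → k[x1,x2,x3,t_r,t_f,t_g]`. -/
def embP : MvPolynomial (Fin 3) k →ₐ[k] MvPolynomial (Fin 6) k := rename ι36

/-- The substitution map `π : t_r ↦ r, t_f ↦ f, t_g ↦ g` (fixing `x1,x2,x3`). -/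
def piMap : MvPolynomial (Fin 6) k →ₐ[k] MvPolynomial (Fin 3) k :=
  aeval ![X 0, X 1, X 2, rP, fP, gP]

/-- The triangular derivation
`Δ' = -2 t_r t_f ∂/∂x1 + (4 x1 t_r - t_g) ∂/∂x2 + (6 x2 t_r + 2 t_f²) ∂/∂x3 - t_f t_g ∂/∂t_r`. -/
def Del' (p : MvPolynomial (Fin 6) k) : MvPolynomial (Fin 6) k :=
  (-(2 * X 3 * X 4)) * pderiv 0 p + (4 * X 0 * X 3 - X 5) * pderiv 1 p +
  (6 * X 1 * X 3 + 2 * X 4 ^ 2) * pderiv 2 p + (-(X 4 * X 5)) * pderiv 3 p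

/-- The weight `w1 = (1,2,3,1,0,1)`. -/
def w1 : Fin 6 → ℕ := ![1, 2, 3, 1, 0, 1]

/-- The weight `w2 = (0,0,0,0,1,0)`. -/
def w2 : Fin 6 → ℕ := ![0, 0, 0, 0, 1, 0]

/-- The sixth cyclic lexicographic order on exponent vectors: first compare the
exponent of `t_g`, then lexicographically the exponents of `x1,x2,x3,t_r,t_f`. -/
def cyclicLt (a b : Fin 6 →₀ ℕ) : Prop :=
  a 5 < b 5 ∨ (a 5 = b 5 ∧ ∃ m : Fin 5,
    (∀ l : Fin 5, l < m → a l.castSucc = b l.castSucc) ∧ a m.castSucc < b m.castSucc)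

/-- The leading monomial of `p` (for the sixth cyclic lexicographic order) is `m`. -/
def LeadMonIs (p : MvPolynomial (Fin 6) k) (m : Fin 6 →₀ ℕ) : Prop :=
  m ∈ p.support ∧ ∀ m' ∈ p.support, m' ≠ m → cyclicLt m' m

/-- The exponent vector of the monomial `t_f^δ t_g^γ`. -/
def tfMon (γ δ : ℕ) : Fin 6 →₀ ℕ := Finsupp.single 4 δ + Finsupp.single 5 γ

/-- The set `P_{γ,δ}`. -/
def Pset (γ δ : ℕ) : Set (MvPolynomial (Fin 6) k) :=
  {p | p ≠ 0 ∧ weightedTotalDegree w1 p ≤ γ ∧ weightedTotalDegree w2 p ≤ δ ∧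
    LeadMonIs p (tfMon γ δ)}

/-- `α'` is a lift of `α`. -/
def IsLift (α : MvPolynomial (Fin 3) k ≃ₐ[k] MvPolynomial (Fin 3) k)
    (α' : MvPolynomial (Fin 6) k →ₐ[k] MvPolynomial (Fin 6) k) : Prop :=
  (∀ i : Fin 3, α' (X (ι36 i)) = embP (α (X i))) ∧
  (∀ p, piMap (α' p) = α (piMap p))

/-- `t = γ_j = max {i | a_{i,j} ≠ 0}` (with rows indexed `1,2,3`). -/
def TypeIs (A : Matrix (Fin 3) (Fin 3) k) (j : Fin 3) (t : ℕ) : Prop :=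
  ∃ i : Fin 3, t = (i : ℕ) + 1 ∧ A i j ≠ 0 ∧ ∀ i' : Fin 3, i < i' → A i' j = 0

/-- Condition (C) for a lift `α'` of an affine automorphism of type `(γ1,γ2,γ3)`,
relative to `φ' = exp(uΔ')`. -/
def CondC (γ1 γ2 γ3 : ℕ) (φ' : MvPolynomial (Fin 6) k ≃ₐ[k] MvPolynomial (Fin 6) k)
    (α' : MvPolynomial (Fin 6) k →ₐ[k] MvPolynomial (Fin 6) k) : Prop :=
  ∃ m4 m5 m6 n4 n5 n6 : ℕ,
    1 ≤ n4 ∧ 1 ≤ n5 ∧ 1 ≤ n6 ∧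
    φ' (α' (X 3)) ∈ Pset m4 n4 ∧
    φ' (α' (X 4)) ∈ Pset m5 n5 ∧
    φ' (α' (X 5)) ∈ Pset m6 n6 ∧
    γ1 ≤ m6 ∧ γ2 ≤ 2 * m6 ∧ γ3 ≤ 3 * m6 ∧ m4 ≤ m6 ∧
    γ1 + 1 ≤ n6 - 1 ∧ γ2 + 1 ≤ 2 * (n6 - 1) ∧ γ3 + 1 ≤ 3 * (n6 - 1) ∧ n4 ≤ n6 - 1

/-- The image of `x_j` under the affine map given by `(A, d)`, inside the six-variable ring. -/
def affImg (A : Matrix (Fin 3) (Fin 3) k) (d : Fin 3 → k) (j : Fin 3) :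
    MvPolynomial (Fin 6) k :=
  (∑ i : Fin 3, C (A i j) * X (ι36 i)) + C (d j)

/-- The image of `t_f` under the lift `α̂`:
`α̂(t_f) = α(f) + (a_{1,1}a_{3,3} - 2a_{1,2}a_{3,2} + a_{1,3}a_{3,1})(t_f - f)`. -/
def hatTf (A : Matrix (Fin 3) (Fin 3) k) (d : Fin 3 → k) : MvPolynomial (Fin 6) k :=
  (affImg A d 0 * affImg A d 2 - affImg A d 1 ^ 2) +
    C (A 0 0 * A 2 2 - 2 * (A 0 1 * A 2 1) + A 0 2 * A 2 0) *
      (X 4 - (X 0 * X 2 - X 1 ^ 2))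

/-- The lift `α̂` of the affine automorphism given by `(A, d)`:
`α̂(x_i) = α(x_i)`, `α̂(t_f)` as in `hatTf`, `α̂(t_r) = α̂(x2 t_f + x1²)`,
`α̂(t_g) = α̂(x3 t_f² + 2 x1 x2 t_f + x1³)`. -/
def hatLift (A : Matrix (Fin 3) (Fin 3) k) (d : Fin 3 → k) :
    MvPolynomial (Fin 6) k →ₐ[k] MvPolynomial (Fin 6) k :=
  aeval ![affImg A d 0, affImg A d 1, affImg A d 2,
    affImg A d 1 * hatTf A d + affImg A d 0 ^ 2,
    hatTf A d,
    affImg A d 2 * hatTf A d ^ 2 + 2 * affImg A d 0 * affImg A d 1 * hatTf A d +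
      affImg A d 0 ^ 3]

/-- `p` has `w1`-degree at most `γ`, `w2`-degree at most `δ`, and the coefficient of
`t_f^δ t_g^γ` in `p` is `c`. -/
def HasLead (γ δ : ℕ) (c : k) (p : MvPolynomial (Fin 6) k) : Prop :=
  (∀ m ∈ p.support, Finsupp.weight w1 m ≤ γ ∧ Finsupp.weight w2 m ≤ δ) ∧
    coeff (tfMon γ δ) p = c

lemma weight_w1 (m : Fin 6 →₀ ℕ) :
    Finsupp.weight w1 m = m 0 + 2 * m 1 + 3 * m 2 + m 3 + m 5 := by
  rw [Finsupp.weight_apply, Finsupp.sum_fintype _ _ (by simp)]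
  simp [Fin.sum_univ_six, w1]
  ring

lemma weight_w2 (m : Fin 6 →₀ ℕ) : Finsupp.weight w2 m = m 4 := by
  rw [Finsupp.weight_apply, Finsupp.sum_fintype _ _ (by simp)]
  simp [Fin.sum_univ_six, w2]

lemma eq_tfMon_iff {m : Fin 6 →₀ ℕ} {γ δ : ℕ} :
    m = tfMon γ δ ↔ m 0 = 0 ∧ m 1 = 0 ∧ m 2 = 0 ∧ m 3 = 0 ∧ m 4 = δ ∧ m 5 = γ := by
  rw [Finsupp.ext_iff]
  simp [Fin.forall_fin_succ, tfMon, Finsupp.single_apply]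

lemma pderiv_ofNat {σ : Type*} (i : σ) (n : ℕ) [n.AtLeastTwo] :
    pderiv i (ofNat(n) : MvPolynomial σ k) = 0 :=
  Derivation.map_natCast _ n

namespace HasLead

variable {γ δ γ' δ' : ℕ} {c c' : k} {p q : MvPolynomial (Fin 6) k}

lemma add (hp : HasLead γ δ c p) (hq : HasLead γ δ c' q) : HasLead γ δ (c + c') (p + q) := by
  refine ⟨fun m hm => ?_, by rw [coeff_add, hp.2, hq.2]⟩
  rcases Finset.mem_union.1 (support_add hm) with h | h
  exacts [hp.1 m h, hq.1 m h]

lemma mul (hp : HasLead γ δ c p) (hq : HasLead γ' δ' c' q) :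
    HasLead (γ + γ') (δ + δ') (c * c') (p * q) := by
  constructor
  · intro m hm
    obtain ⟨a, ha, b, hb, rfl⟩ := Finset.mem_add.1 (support_mul p q hm)
    have h₁ := hp.1 a ha
    have h₂ := hq.1 b hb
    simp only [map_add]
    omega
  · rw [coeff_mul, Finset.sum_eq_single (tfMon γ δ, tfMon γ' δ'), hp.2, hq.2]
    · rintro ⟨a, b⟩ hab hne
      by_contra h0
      have h₁ := hp.1 a (mem_support_iff.2 (left_ne_zero_of_mul h0))
      have h₂ := hq.1 b (mem_support_iff.2 (right_ne_zero_of_mul h0))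
      have h := eq_tfMon_iff.1 (Finset.HasAntidiagonal.mem_antidiagonal.1 hab)
      simp only [Finsupp.add_apply] at h
      rw [weight_w1, weight_w2] at h₁ h₂
      refine hne (Prod.ext (eq_tfMon_iff.2 ?_) (eq_tfMon_iff.2 ?_)) <;> simp only <;> omega
    · intro h
      refine absurd (Finset.HasAntidiagonal.mem_antidiagonal.2 (eq_tfMon_iff.2 ?_)) h
      simp [tfMon]

lemma mono (hp : HasLead γ δ c p) (hγ : γ ≤ γ') (hδ : δ ≤ δ') (h : γ < γ' ∨ δ < δ' ∨ c = 0) :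
    HasLead γ' δ' 0 p := by
  refine ⟨fun m hm => ⟨(hp.1 m hm).1.trans hγ, (hp.1 m hm).2.trans hδ⟩, ?_⟩
  by_contra h0
  have hm := eq_tfMon_iff.1 (rfl : tfMon γ' δ' = tfMon γ' δ')
  have hb := hp.1 _ (mem_support_iff.2 h0)
  rw [weight_w1, weight_w2] at hb
  rcases h with h | h | h
  · omega
  · omega
  · obtain rfl : γ = γ' := by omega
    obtain rfl : δ = δ' := by omega
    exact h0 (hp.2.trans h)

lemma add_lower (hp : HasLead γ δ c p) (hq : HasLead γ' δ' c' q) (hγ : γ' ≤ γ) (hδ : δ' ≤ δ)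
    (h : γ' < γ ∨ δ' < δ ∨ c' = 0) : HasLead γ δ c (p + q) := by
  simpa using hp.add (hq.mono hγ hδ h)

lemma monomial (m : Fin 6 →₀ ℕ) (a : k) (hγ : Finsupp.weight w1 m ≤ γ)
    (hδ : Finsupp.weight w2 m ≤ δ) :
    HasLead γ δ (if m = tfMon γ δ then a else 0) (MvPolynomial.monomial m a) := by
  classical
  refine ⟨fun n hn => ?_, by rw [coeff_monomial]⟩
  obtain rfl : n = m := Finset.mem_singleton.1 (support_monomial_subset hn)
  exact ⟨hγ, hδ⟩

lemma zero : HasLead γ δ (0 : k) 0 := by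
  simp [HasLead]

lemma sum {ι : Type*} {s : Finset ι} {a : ι → k} {P : ι → MvPolynomial (Fin 6) k}
    (h : ∀ i ∈ s, HasLead γ δ (a i) (P i)) :
    HasLead γ δ (∑ i ∈ s, a i) (∑ i ∈ s, P i) := by
  classical
  induction s using Finset.induction_on with
  | empty => simpa using zero
  | insert i s hi ih =>
    rw [Finset.sum_insert hi, Finset.sum_insert hi]
    exact (h i (s.mem_insert_self i)).add (ih fun j hj => h j (Finset.mem_insert_of_mem hj))

lemma const (a : k) : HasLead 0 0 a (C a) := by
  simpa [tfMon] using monomial (γ := 0) (δ := 0) 0 a (by simp) (by simp)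

lemma const_mul (a : k) (hp : HasLead γ δ c p) : HasLead γ δ (a * c) (C a * p) := by
  simpa using (const a).mul hp

lemma ofNat_mul (n : ℕ) [n.AtLeastTwo] (hp : HasLead γ δ c p) :
    HasLead γ δ (OfNat.ofNat n * c) (OfNat.ofNat n * p) := by
  simpa only [map_ofNat] using hp.const_mul (OfNat.ofNat n)

lemma neg (hp : HasLead γ δ c p) : HasLead γ δ (-c) (-p) := by
  simpa using hp.const_mul (-1)

lemma var (i : Fin 6) (hγ : w1 i ≤ γ) (hδ : w2 i ≤ δ) :
    HasLead γ δ (if Finsupp.single i 1 = tfMon γ δ then 1 else 0)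
      (X i : MvPolynomial (Fin 6) k) :=
  monomial _ 1 (by simpa [Finsupp.weight_single] using hγ)
    (by simpa [Finsupp.weight_single] using hδ)

lemma tf : HasLead 0 1 1 (X 4 : MvPolynomial (Fin 6) k) := by
  simpa [tfMon] using var (k := k) (γ := 0) (δ := 1) 4 (by simp [w1]) (by simp [w2])

lemma tg : HasLead 1 0 1 (X 5 : MvPolynomial (Fin 6) k) := by
  simpa [tfMon] using var (k := k) (γ := 1) (δ := 0) 5 (by simp [w1]) (by simp [w2])

lemma var_of_lt {i : Fin 6} (hi : i < 4) :
    HasLead (w1 i) 0 0 (X i : MvPolynomial (Fin 6) k) := by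
  have h : Finsupp.single i 1 ≠ tfMon (w1 i) 0 := by
    rw [Ne, eq_tfMon_iff]
    fin_cases i <;> simp_all
  simpa [h] using var (k := k) (γ := w1 i) (δ := 0) i le_rfl (by fin_cases i <;> simp_all [w2])

lemma mem_Pset (hp : HasLead γ δ c p) (hc : c ≠ 0) : p ∈ Pset γ δ := by
  have hmem : tfMon γ δ ∈ p.support := mem_support_iff.2 (hp.2 ▸ hc)
  refine ⟨fun h => ?_, Finset.sup_le fun m hm => (hp.1 m hm).1,
    Finset.sup_le fun m hm => (hp.1 m hm).2, hmem, fun m hm hne => ?_⟩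
  · simp [h] at hmem
  · have hb := hp.1 m hm
    rw [weight_w1, weight_w2] at hb
    obtain ⟨e0, e1, e2, e3, e4, e5⟩ :=
      eq_tfMon_iff.1 (rfl : tfMon γ δ = tfMon γ δ)
    rw [Ne, eq_tfMon_iff] at hne
    rcases lt_or_ge (m 5) γ with h | h
    · exact Or.inl (by omega)
    · refine Or.inr ⟨by omega, 4, fun l hl => ?_, ?_⟩
      · have h₀ : m 0 = 0 ∧ m 1 = 0 ∧ m 2 = 0 ∧ m 3 = 0 := by omega
        fin_cases l <;> simp_all
      · change m 4 < tfMon γ δ 4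
        omega

end HasLead

lemma iterate_smul_Del' (u : k) (i : ℕ) (p : MvPolynomial (Fin 6) k) :
    (fun p => u • Del' p)^[i] p = u ^ i • Del'^[i] p := by
  have h : ∀ (a : k) (q : MvPolynomial (Fin 6) k), Del' (a • q) = a • Del' q := fun a q => by
    simp [Del', smul_add]
  induction i with
  | zero => simp
  | succ i ih => simp only [Function.iterate_succ_apply', ih, h, smul_smul, pow_succ']

section Exp

variable {u : k} {φ' : MvPolynomial (Fin 6) k ≃ₐ[k] MvPolynomial (Fin 6) k}

lemma exp_tf (hφ' : IsExpOf (fun p => u • Del' p) φ') : φ' (X 4) = X 4 := by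
  rw [hφ' (X 4) 1 (by simp [Del', pderiv_X])]
  simp

variable [CharZero k]

/-- If `e 0, …, e N` is the orbit of `e 0` under `Δ'` up to its last nonzero term, then the leading
coefficient of `exp (uΔ') (e 0)` comes from that of `e N`. -/
lemma HasLead.exp_of_chain (hu : u ≠ 0) (hφ' : IsExpOf (fun p => u • Del' p) φ')
    {N γ δ : ℕ} {c : k} (hc : c ≠ 0) (e : Fin (N + 1) → MvPolynomial (Fin 6) k)
    (hs : ∀ i : Fin N, Del' (e i.castSucc) = e i.succ) (hN : Del' (e (Fin.last N)) = 0)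
    (hlow : ∀ i : Fin N, HasLead γ δ 0 (e i.castSucc)) (hlast : HasLead γ δ c (e (Fin.last N))) :
    ∃ c' ≠ 0, HasLead γ δ c' (φ' (e 0)) := by
  have hit : ∀ i : Fin (N + 1), Del'^[i] (e 0) = e i := fun i => by
    induction i using Fin.induction with
    | zero => rfl
    | succ i ih => rw [Fin.val_succ, Function.iterate_succ_apply', ← hs, ← ih, Fin.val_castSucc]
  have hlast_it : Del'^[N] (e 0) = e (Fin.last N) := hit (Fin.last N)
  have hφ := hφ' (e 0) (N + 1) (by
    rw [iterate_smul_Del', Function.iterate_succ_apply', hlast_it, hN, smul_zero])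
  simp only [iterate_smul_Del', smul_smul, Finset.sum_range_succ, hlast_it] at hφ
  simp only [smul_eq_C_mul] at hφ
  have hzero : HasLead γ δ (∑ i ∈ Finset.range N, (0 : k))
      (∑ i ∈ Finset.range N, C ((i.factorial : k)⁻¹ * u ^ i) * Del'^[i] (e 0)) := by
    refine HasLead.sum fun i hi => ?_
    have h := hlow ⟨i, Finset.mem_range.1 hi⟩
    rw [← hit] at h
    simpa only [mul_zero, Fin.val_castSucc] using h.const_mul ((i.factorial : k)⁻¹ * u ^ i)
  rw [Finset.sum_const_zero] at hzero
  have h := hzero.add (hlast.const_mul ((N.factorial : k)⁻¹ * u ^ N))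
  rw [zero_add, ← hφ] at h
  exact ⟨_, by simp [hu, hc, Nat.factorial_ne_zero], h⟩

lemma hasLead_exp_x1 (hu : u ≠ 0) (hφ' : IsExpOf (fun p => u • Del' p) φ') :
    ∃ c ≠ 0, HasLead 1 2 c (φ' (X 0)) := by
  have hx1 : HasLead 1 0 (0 : k) (X 0) := HasLead.var_of_lt (i := 0) (by decide)
  have hr : HasLead 1 0 (0 : k) (X 3) := HasLead.var_of_lt (i := 3) (by decide)
  refine HasLead.exp_of_chain hu hφ' (c := 2 * (1 * 1 * 1)) (by simp)
    ![X 0, -(2 * (X 3 * X 4)), 2 * (X 4 * X 4 * X 5)] ?_ ?_ ?_ ?_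
  · intro i
    fin_cases i <;> simp [Del', pderiv_X, pderiv_ofNat] <;> ring
  · simp [Del', pderiv_X, pderiv_ofNat]
  · intro i
    fin_cases i
    · exact hx1.mono (by simp) (by simp) (by simp)
    · exact ((hr.mul .tf).ofNat_mul 2).neg.mono (by simp) (by simp) (by simp)
  · exact ((HasLead.tf.mul .tf).mul .tg).ofNat_mul 2

lemma hasLead_exp_x2 (hu : u ≠ 0) (hφ' : IsExpOf (fun p => u • Del' p) φ') :
    ∃ c ≠ 0, HasLead 2 3 c (φ' (X 1)) := by
  have hx1 : HasLead 1 0 (0 : k) (X 0) := HasLead.var_of_lt (i := 0) (by decide)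
  have hx2 : HasLead 2 0 (0 : k) (X 1) := HasLead.var_of_lt (i := 1) (by decide)
  have hr : HasLead 1 0 (0 : k) (X 3) := HasLead.var_of_lt (i := 3) (by decide)
  refine HasLead.exp_of_chain hu hφ' (c := -(24 * (1 * 1 * 1 * 1 * 1))) (by simp)
    ![X 1,
      4 * (X 0 * X 3) + -X 5,
      -(8 * (X 3 * X 3 * X 4)) + -(4 * (X 0 * X 4 * X 5)),
      24 * (X 3 * X 4 * X 4 * X 5),
      -(24 * (X 4 * X 4 * X 4 * X 5 * X 5))] ?_ ?_ ?_ ?_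
  · intro i
    fin_cases i <;> simp [Del', pderiv_X, pderiv_ofNat] <;> ring
  · simp [Del', pderiv_X, pderiv_ofNat]
  · intro i
    fin_cases i
    · exact hx2.mono (by simp) (by simp) (by simp)
    · exact (((hx1.mul hr).ofNat_mul 4).add_lower (HasLead.tg (k := k)).neg (by simp) (by simp)
        (by simp)).mono (by simp) (by simp) (by simp)
    · exact (((hr.mul hr).mul .tf).ofNat_mul 8).neg.add
        (((hx1.mul .tf).mul .tg).ofNat_mul 4).neg |>.mono (by simp) (by simp) (by simp)
    · exact ((((hr.mul .tf).mul .tf).mul .tg).ofNat_mul 24).mono (by simp) (by simp) (by simp)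
  · exact (((((HasLead.tf.mul .tf).mul .tf).mul .tg).mul .tg).ofNat_mul 24).neg

lemma hasLead_exp_x3 (hu : u ≠ 0) (hφ' : IsExpOf (fun p => u • Del' p) φ') :
    ∃ c ≠ 0, HasLead 3 4 c (φ' (X 2)) := by
  have hx1 : HasLead 1 0 (0 : k) (X 0) := HasLead.var_of_lt (i := 0) (by decide)
  have hx2 : HasLead 2 0 (0 : k) (X 1) := HasLead.var_of_lt (i := 1) (by decide)
  have hx3 : HasLead 3 0 (0 : k) (X 2) := HasLead.var_of_lt (i := 2) (by decide)
  have hr : HasLead 1 0 (0 : k) (X 3) := HasLead.var_of_lt (i := 3) (by decide)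
  refine HasLead.exp_of_chain hu hφ' (c := 720 * (1 * 1 * 1 * 1 * 1 * 1 * 1)) (by simp)
    ![X 2,
      6 * (X 1 * X 3) + 2 * (X 4 * X 4),
      24 * (X 0 * X 3 * X 3) + -(6 * (X 1 * X 4 * X 5)) + -(6 * (X 3 * X 5)),
      -(48 * (X 3 * X 3 * X 3 * X 4)) + -(72 * (X 0 * X 3 * X 4 * X 5)) + 12 * (X 4 * X 5 * X 5),
      288 * (X 3 * X 3 * X 4 * X 4 * X 5) + 72 * (X 0 * X 4 * X 4 * X 5 * X 5),
      -(720 * (X 3 * X 4 * X 4 * X 4 * X 5 * X 5)),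
      720 * (X 4 * X 4 * X 4 * X 4 * X 5 * X 5 * X 5)] ?_ ?_ ?_ ?_
  · intro i
    fin_cases i <;> simp [Del', pderiv_X, pderiv_ofNat] <;> ring
  · simp [Del', pderiv_X, pderiv_ofNat]
  · intro i
    fin_cases i
    · exact hx3.mono (by simp) (by simp) (by simp)
    · exact (((hx2.mul hr).ofNat_mul 6).mono (by simp) (by simp) (by simp)).add_lower
        ((HasLead.tf.mul .tf).ofNat_mul 2) (by simp) (by simp) (by simp)
    · exact (((((hx1.mul hr).mul hr).ofNat_mul 24).mono (by simp) (by simp) (by simp)).add_lower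
        (((hx2.mul .tf).mul .tg).ofNat_mul 6).neg (by simp) (by simp) (by simp)).add_lower
        ((hr.mul .tg).ofNat_mul 6).neg (by simp) (by simp) (by simp)
    · exact ((((((hr.mul hr).mul hr).mul .tf).ofNat_mul 48).neg.mono
        (by simp) (by simp) (by simp)).add_lower
        ((((hx1.mul hr).mul .tf).mul .tg).ofNat_mul 72).neg (by simp) (by simp) (by simp)).add_lower
        (((HasLead.tf.mul .tg).mul .tg).ofNat_mul 12) (by simp) (by simp) (by simp)
    · exact ((((((hr.mul hr).mul .tf).mul .tf).mul .tg).ofNat_mul 288).mono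
        (by simp) (by simp) (by simp)).add_lower
        (((((hx1.mul .tf).mul .tf).mul .tg).mul .tg).ofNat_mul 72) (by simp) (by simp) (by simp)
    · exact ((((((hr.mul .tf).mul .tf).mul .tf).mul .tg).mul .tg).ofNat_mul 720).neg.mono
        (by simp) (by simp) (by simp)
  · exact ((((((HasLead.tf.mul .tf).mul .tf).mul .tf).mul .tg).mul .tg).mul .tg).ofNat_mul 720

lemma hasLead_affImg (hu : u ≠ 0) (hφ' : IsExpOf (fun p => u • Del' p) φ')
    {A : Matrix (Fin 3) (Fin 3) k} (d : Fin 3 → k) {j : Fin 3} {t : ℕ} (ht : TypeIs A j t) :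
    ∃ c ≠ 0, HasLead t (t + 1) c (φ' (affImg A d j)) := by
  obtain ⟨c₁, hc₁, h₁⟩ := hasLead_exp_x1 hu hφ'
  obtain ⟨c₂, hc₂, h₂⟩ := hasLead_exp_x2 hu hφ'
  obtain ⟨c₃, hc₃, h₃⟩ := hasLead_exp_x3 hu hφ'
  have hC : ∀ a, φ' (C a) = C a := fun a => φ'.commutes a
  have h : φ' (affImg A d j) = C (A 2 j) * φ' (X 2) + C (A 1 j) * φ' (X 1) +
      C (A 0 j) * φ' (X 0) + C (d j) := by
    simp only [affImg, Fin.sum_univ_three, map_add, map_mul, hC]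
    change C (A 0 j) * φ' (X 0) + C (A 1 j) * φ' (X 1) + C (A 2 j) * φ' (X 2) + C (d j) = _
    ring
  rw [h]
  obtain ⟨i, rfl, hi, hz⟩ := ht
  fin_cases i
  · rw [hz 1 (by decide), hz 2 (by decide), C_0, zero_mul, zero_mul, zero_add, zero_add]
    exact ⟨_, mul_ne_zero hi hc₁,
      (h₁.const_mul _).add_lower (HasLead.const _) (by simp) (by simp) (by simp)⟩
  · rw [hz 2 (by decide), C_0, zero_mul, zero_add]
    exact ⟨_, mul_ne_zero hi hc₂, ((h₂.const_mul _).add_lower (h₁.const_mul _)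
      (by simp) (by simp) (by simp)).add_lower (HasLead.const _) (by simp) (by simp) (by simp)⟩
  · exact ⟨_, mul_ne_zero hi hc₃, (((h₃.const_mul _).add_lower (h₂.const_mul _)
      (by simp) (by simp) (by simp)).add_lower (h₁.const_mul _)
      (by simp) (by simp) (by simp)).add_lower (HasLead.const _) (by simp) (by simp) (by simp)⟩

lemma hasLead_hatTf (hu : u ≠ 0) (hφ' : IsExpOf (fun p => u • Del' p) φ')
    {A : Matrix (Fin 3) (Fin 3) k} (d : Fin 3 → k) {γ1 γ2 γ3 : ℕ}
    (ht1 : TypeIs A 0 γ1) (ht2 : TypeIs A 1 γ2) (ht3 : TypeIs A 2 γ3)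
    (hsum : γ1 + γ3 = 5) (hγ2 : γ2 ≤ 2) : ∃ c ≠ 0, HasLead 5 7 c (φ' (hatTf A d)) := by
  obtain ⟨c₁, -, h₁⟩ := hasLead_exp_x1 hu hφ'
  obtain ⟨c₂, -, h₂⟩ := hasLead_exp_x2 hu hφ'
  obtain ⟨c₃, -, h₃⟩ := hasLead_exp_x3 hu hφ'
  obtain ⟨a₁, ha₁, g₁⟩ := hasLead_affImg hu hφ' d ht1
  obtain ⟨a₂, -, g₂⟩ := hasLead_affImg hu hφ' d ht2
  obtain ⟨a₃, ha₃, g₃⟩ := hasLead_affImg hu hφ' d ht3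
  have hC : ∀ a, φ' (C a) = C a := fun a => φ'.commutes a
  have hlead := g₁.mul g₃
  rw [hsum, show γ1 + 1 + (γ3 + 1) = 7 by omega] at hlead
  have htf : HasLead 4 6 _ (X 4 + (-(φ' (X 0) * φ' (X 2)) + φ' (X 1) * φ' (X 1))) :=
    ((HasLead.tf (k := k)).mono (by simp) (by simp) (by simp)).add
      ((h₁.mul h₃).neg.add (h₂.mul h₂))
  have h := (hlead.add_lower (g₂.mul g₂).neg (by omega) (by omega) (by omega)).add_lower
    (htf.const_mul (A 0 0 * A 2 2 - 2 * (A 0 1 * A 2 1) + A 0 2 * A 2 0))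
    (by simp) (by simp) (by simp)
  refine ⟨_, mul_ne_zero ha₁ ha₃, ?_⟩
  convert h using 1
  simp only [hatTf, map_add, map_sub, map_mul, map_pow, hC, exp_tf hφ']
  ring

end Exp

/-- (Lemma 4 of the paper.)  If the type of
`α ∈ Aff_3(k) \ B` satisfies `(γ1,γ3) ∈ {(3,2),(2,3)}` and `γ2 ≤ 2`,
then the lift `α̂` satisfies condition (C). -/
theorem statement16 [CharZero k]
    (hln6 : ∀ p : MvPolynomial (Fin 6) k, ∃ l : ℕ, Del'^[l] p = 0)
    (u : k) (hu : u ≠ 0)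
    (φ' : MvPolynomial (Fin 6) k ≃ₐ[k] MvPolynomial (Fin 6) k)
    (hφ' : IsExpOf (fun p => u • Del' p) φ')
    (α : MvPolynomial (Fin 3) k ≃ₐ[k] MvPolynomial (Fin 3) k)
    (A : Matrix (Fin 3) (Fin 3) k) (d : Fin 3 → k)
    (hdet : IsUnit A.det)
    (hαA : ∀ i : Fin 3, α (X i) = (∑ j : Fin 3, C (A j i) * X j) + C (d i))
    (hαB : α ∉ BSet)
    (γ1 γ2 γ3 : ℕ)
    (ht1 : TypeIs A 0 γ1) (ht2 : TypeIs A 1 γ2) (ht3 : TypeIs A 2 γ3)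
    (hcase : ((γ1 = 3 ∧ γ3 = 2) ∨ (γ1 = 2 ∧ γ3 = 3)) ∧ γ2 ≤ 2) :
    CondC γ1 γ2 γ3 φ' (hatLift A d) := by
  have hsum : γ1 + γ3 = 5 := by omega
  have hγ2 : 1 ≤ γ2 := by
    obtain ⟨i, rfl, -⟩ := ht2
    omega
  obtain ⟨a₁, -, g₁⟩ := hasLead_affImg hu hφ' d ht1
  obtain ⟨a₂, ha₂, g₂⟩ := hasLead_affImg hu hφ' d ht2
  obtain ⟨a₃, ha₃, g₃⟩ := hasLead_affImg hu hφ' d ht3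
  obtain ⟨b, hb, hf⟩ := hasLead_hatTf hu hφ' d ht1 ht2 ht3 hsum hcase.2
  have hr := (g₂.mul hf).add_lower (g₁.mul g₁) (by omega) (by omega) (by omega)
  have hg := ((g₃.mul (hf.mul hf)).add_lower (((g₁.mul g₂).ofNat_mul 2).mul hf)
    (by omega) (by omega) (by omega)).add_lower ((g₁.mul g₁).mul g₁)
    (by omega) (by omega) (by omega)
  refine ⟨γ2 + 5, 5, γ3 + (5 + 5), γ2 + 1 + 7, 7, γ3 + 1 + (7 + 7), by omega, by omega, by omega,
    ?_, ?_, ?_, by omega⟩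
  · convert hr.mem_Pset (mul_ne_zero ha₂ hb) using 1
    simp [hatLift, sq]
  · convert hf.mem_Pset hb using 1
    simp [hatLift]
  · convert hg.mem_Pset (mul_ne_zero ha₃ (mul_ne_zero hb hb)) using 1
    have h2 : φ' 2 = 2 := map_ofNat φ' 2
    simp [hatLift, h2]
    ring

end YasudaPaper
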